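/- The ring W(R) of Witt vectors with coefficients in R is an integral domain, and the map θ : W(R) → O_C sending (a₀, a₁, a₂, …) to Σ_{n∈N} p^n a_n^{(n)} is a surjective ring homomorphism whose kernel is the principal ideal generated by ξ = [π] − p, where π ∈ R satisfies π^(0) = p and [·] denotes the Teichmüller representative. -/

import Mathlib

/-!
STATEMENT 10.
The ring `W(R)` of Witt vectors with coefficients in `R` (the valuation ring of the
tilt `FR` of `C`) is an integral domain, and the map `θ : W(R) → O_C` sending
`(a₀, a₁, a₂, …)` to `Σ pⁿ aₙ^(n)` is a surjective ring homomorphism whose kernel is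
the principal ideal generated by `ξ = [π] − p`, where `π ∈ R` satisfies `π^(0) = p`
and `[·]` is the Teichmüller representative.
-/

open Filter Topology

section IntegerRing

variable {p : ℕ} [Fact p.Prime] {C : Type*} [NormedField C] {OC : Subring C}

theorem mem_span_natCast_pow_iff_norm_le (hnorm : ‖(p : C)‖ = (p : ℝ)⁻¹)
    (hOC : ∀ c : C, c ∈ OC ↔ ‖c‖ ≤ 1) (x : OC) (n : ℕ) :
    x ∈ Ideal.span {(p : OC)} ^ n ↔ ‖(x : C)‖ ≤ (p : ℝ)⁻¹ ^ n := by
  have hp : (0 : ℝ) < p := Nat.cast_pos.mpr (Fact.out : p.Prime).pos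
  have hp0 : (p : C) ≠ 0 := norm_ne_zero_iff.mp (by rw [hnorm]; positivity)
  rw [Ideal.span_singleton_pow, Ideal.mem_span_singleton]
  constructor
  · rintro ⟨y, rfl⟩
    have hy : ‖(y : C)‖ ≤ 1 := (hOC _).mp y.2
    push_cast
    rw [norm_mul, norm_pow, hnorm]
    exact mul_le_of_le_one_right (by positivity) hy
  · intro hx
    refine ⟨⟨x / (p : C) ^ n, (hOC _).mpr ?_⟩, Subtype.ext ?_⟩
    · rw [norm_div, norm_pow, hnorm]
      exact div_le_one_of_le₀ hx (by positivity)
    · push_cast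
      field_simp

theorem not_isUnit_natCast_of_norm_eq_inv (hnorm : ‖(p : C)‖ = (p : ℝ)⁻¹)
    (hOC : ∀ c : C, c ∈ OC ↔ ‖c‖ ≤ 1) : ¬ IsUnit (p : OC) := by
  rw [← Ideal.span_singleton_eq_top, Ideal.eq_top_iff_one, ← pow_one (Ideal.span _),
    mem_span_natCast_pow_iff_norm_le hnorm hOC]
  have := inv_lt_one_of_one_lt₀ (Nat.one_lt_cast (α := ℝ).mpr (Fact.out : p.Prime).one_lt)
  simpa using this

theorem isAdicComplete_span_natCast [CompleteSpace C] (hnorm : ‖(p : C)‖ = (p : ℝ)⁻¹)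
    (hOC : ∀ c : C, c ∈ OC ↔ ‖c‖ ≤ 1) : IsAdicComplete (Ideal.span {(p : OC)}) OC := by
  have hlt : (p : ℝ)⁻¹ < 1 :=
    inv_lt_one_of_one_lt₀ (Nat.one_lt_cast (α := ℝ).mpr (Fact.out : p.Prime).one_lt)
  have hlim : Tendsto (fun n : ℕ => (p : ℝ)⁻¹ ^ n) atTop (𝓝 0) :=
    tendsto_pow_atTop_nhds_zero_of_lt_one (by positivity) hlt
  have key (x y : OC) (n : ℕ) :
      x ≡ y [SMOD (Ideal.span {(p : OC)} ^ n • ⊤ : Submodule OC OC)] ↔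
        ‖(x : C) - y‖ ≤ (p : ℝ)⁻¹ ^ n := by
    rw [SModEq.sub_mem, smul_eq_mul, Ideal.mul_top, mem_span_natCast_pow_iff_norm_le hnorm hOC]
    simp
  refine { haus' := fun x hx => ?_, prec' := fun f hf => ?_ }
  · simp only [key, ZeroMemClass.coe_zero, sub_zero] at hx
    have := ge_of_tendsto' hlim hx
    exact Subtype.ext (norm_le_zero_iff.mp this)
  · simp only [key] at hf ⊢
    have hc : CauchySeq fun n => (f n : C) :=
      cauchySeq_of_le_tendsto_0' _ (fun n m h => by simpa [dist_eq_norm] using hf h) hlim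
    obtain ⟨L, hL⟩ := cauchySeq_tendsto_of_complete hc
    have hL1 : ‖L‖ ≤ 1 := le_of_tendsto' hL.norm fun n => (hOC _).mp (f n).2
    refine ⟨⟨L, (hOC _).mpr hL1⟩, fun n => ?_⟩
    exact le_of_tendsto (hL.const_sub _).norm (eventually_atTop.mpr ⟨n, fun m hm => hf hm⟩)

theorem frobenius_modP_surjective [IsAlgClosed C] [Fact ¬ IsUnit (p : OC)]
    (hOC : ∀ c : C, c ∈ OC ↔ ‖c‖ ≤ 1) : Function.Surjective (frobenius (ModP OC p) p) := by
  intro x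
  obtain ⟨x, rfl⟩ := Ideal.Quotient.mk_surjective x
  have hp := (Fact.out : p.Prime).pos
  obtain ⟨z, hz⟩ := IsAlgClosed.exists_pow_nat_eq (x : C) hp
  have hz1 : ‖z‖ ≤ 1 := by
    rw [← pow_le_one_iff_of_nonneg (norm_nonneg z) hp.ne', ← norm_pow, hz]
    exact (hOC _).mp x.2
  refine ⟨Ideal.Quotient.mk _ ⟨z, (hOC _).mpr hz1⟩, ?_⟩
  rw [frobenius_def, ← map_pow]
  exact congrArg _ (Subtype.ext hz)

end IntegerRing

/-- If `θ p` is a non-zero-divisor and the kernel of `θ` is contained in `(ξ, p)`, then it is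
generated by `ξ`, provided the source is `p`-adically complete. -/
theorem ker_eq_span_singleton_of_isAdicComplete {A B : Type*} [CommRing A] [CommRing B]
    (θ : A →+* B) (p ξ : A) [IsAdicComplete (Ideal.span {p}) A] (hξ : θ ξ = 0)
    (hp : ∀ b, θ p * b = 0 → b = 0) (h : ∀ a, θ a = 0 → ∃ b c, a = ξ * b + p * c) :
    RingHom.ker θ = Ideal.span {ξ} := by
  refine le_antisymm (fun a ha => ?_) ?_
  · have h' (a : RingHom.ker θ) : ∃ (b : A) (c : RingHom.ker θ), (a : A) = ξ * b + p * c := by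
      obtain ⟨b, c, hbc⟩ := h a a.2
      refine ⟨b, ⟨c, hp _ ?_⟩, hbc⟩
      have := congrArg θ hbc
      rw [RingHom.mem_ker.mp a.2] at this
      simpa [hξ] using this.symm
    choose f g hfg using h'
    let s (n : ℕ) : A := ∑ i ∈ Finset.range n, p ^ i * f (g^[i] ⟨a, ha⟩)
    have hs (n : ℕ) : a = ξ * s n + p ^ n * (g^[n] ⟨a, ha⟩ : RingHom.ker θ) := by
      induction n with
      | zero => simp [s]
      | succ n ih =>
        rw [Function.iterate_succ_apply']
        have h1 := hfg (g^[n] ⟨a, ha⟩)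
        have h2 : s (n + 1) = s n + p ^ n * f (g^[n] ⟨a, ha⟩) := Finset.sum_range_succ _ _
        rw [h2]
        linear_combination ih + p ^ n * h1
    obtain ⟨L, hL⟩ := IsPrecomplete.prec (I := Ideal.span {p}) inferInstance (f := s) (by
      intro m n hmn
      rw [smul_eq_mul, Ideal.mul_top, Ideal.span_singleton_pow]
      symm
      rw [SModEq.sub_mem, ← Finset.sum_Ico_eq_sub _ hmn]
      refine Ideal.sum_mem _ fun i hi => Ideal.mem_span_singleton.mpr ?_
      exact (pow_dvd_pow p (Finset.mem_Ico.mp hi).1).mul_right _)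
    have haL : a = ξ * L := by
      rw [IsHausdorff.eq_iff_smodEq (I := Ideal.span {p})]
      intro n
      have hLn := hL n
      rw [smul_eq_mul, Ideal.mul_top, Ideal.span_singleton_pow, SModEq.sub_mem,
        Ideal.mem_span_singleton] at hLn ⊢
      have : a - ξ * L = ξ * (s n - L) + p ^ n * (g^[n] ⟨a, ha⟩ : RingHom.ker θ) := by
        linear_combination hs n
      rw [this]
      exact dvd_add (hLn.mul_left _) (dvd_mul_right _ _)
    exact Ideal.mem_span_singleton.mpr ⟨L, haL⟩
  · rw [Ideal.span_singleton_le_iff_mem]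
    exact hξ

theorem tilt_pow_pow {p : ℕ} {C FR : Type*} [Monoid C] {co : FR → ℕ → C}
    (hco_pow : ∀ x n, co x (n + 1) ^ p = co x n) (x : FR) (n m : ℕ) :
    co x (n + m) ^ p ^ m = co x n := by
  induction m with
  | zero => simp
  | succ m ih => rw [pow_succ', pow_mul, ← add_assoc, hco_pow, ih]

section Tilt

variable {p : ℕ} [Fact p.Prime] {C : Type*} [NormedField C] {FR : Type*} [Field FR]
  {co : FR → ℕ → C} {R : Subring FR} {OC : Subring C}

theorem tilt_norm_le_one (hco_pow : ∀ x n, co x (n + 1) ^ p = co x n)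
    (hR : ∀ x : FR, x ∈ R ↔ ‖co x 0‖ ≤ 1) (x : FR) (n : ℕ) : x ∈ R ↔ ‖co x n‖ ≤ 1 := by
  have hp : p ^ n ≠ 0 := pow_ne_zero _ (Fact.out : p.Prime).ne_zero
  rw [hR, ← tilt_pow_pow hco_pow x 0 n, norm_pow, zero_add,
    pow_le_one_iff_of_nonneg (norm_nonneg _) hp]

/-- The valuation ring of the tilt is identified with the tilt of the valuation ring, the
component of index `0` corresponding to the untilt map. -/
theorem exists_ringEquiv_preTilt [Fact ¬ IsUnit (p : OC)]
    [IsAdicComplete (Ideal.span {(p : OC)}) OC] (hnorm : ‖(p : C)‖ = (p : ℝ)⁻¹)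
    (hco_inj : Function.Injective co)
    (hco_pow : ∀ x n, co x (n + 1) ^ p = co x n)
    (hco_surj : ∀ f : ℕ → C, (∀ n, f (n + 1) ^ p = f n) → ∃ x, co x = f)
    (hmul : ∀ x y n, co (x * y) n = co x n * co y n)
    (hadd : ∀ x y n, Tendsto (fun m : ℕ => (co x (n + m) + co y (n + m)) ^ p ^ m)
      atTop (𝓝 (co (x + y) n)))
    (hR : ∀ x : FR, x ∈ R ↔ ‖co x 0‖ ≤ 1) (hOC : ∀ c : C, c ∈ OC ↔ ‖c‖ ≤ 1) :
    ∃ e : R ≃+* PreTilt OC p, ∀ x : R, ((e x).untilt : C) = co (x : FR) 0 := by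
  have hmem (x : R) (n : ℕ) : co (x : FR) n ∈ OC :=
    (hOC _).mpr ((tilt_norm_le_one hco_pow hR _ n).mp x.2)
  let g (x : R) : Perfection OC p :=
    ⟨fun n => ⟨co (x : FR) n, hmem x n⟩, fun n => Subtype.ext (hco_pow _ n)⟩
  have hg : Function.Bijective g := by
    constructor
    · intro x y h
      refine Subtype.ext (hco_inj (funext fun n => ?_))
      exact congrArg (fun z : Perfection OC p => ((z.1 n : OC) : C)) h
    · intro f
      obtain ⟨x, hx⟩ := hco_surj (fun n => (f.1 n : C)) fun n => congrArg Subtype.val (f.2 n)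
      refine ⟨⟨x, (hR x).mpr ?_⟩, Subtype.ext (funext fun n => Subtype.ext (congrFun hx n))⟩
      rw [hx]
      exact (hOC _).mp (f.1 0).2
  let G : R ≃* Perfection OC p :=
    { Equiv.ofBijective g hg with
      map_mul' := fun x y => Subtype.ext (funext fun n => Subtype.ext (hmul _ _ n)) }
  let E : R ≃* PreTilt OC p := G.trans (Perfection.quotientMulEquiv p (Ideal.span {(p : OC)}))
  have hE (x : R) (n : ℕ) :
      PreTilt.coeff n (E x) = Ideal.Quotient.mk _ (⟨co (x : FR) n, hmem x n⟩ : OC) := rfl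
  refine ⟨{ E with map_add' := fun x y => ?_ }, fun x => ?_⟩
  · change E (x + y) = E x + E y
    refine Perfection.ext fun n => ?_
    change PreTilt.coeff n (E (x + y)) = PreTilt.coeff n (E x + E y)
    have hp : (0 : ℝ) < (p : ℝ)⁻¹ :=
      inv_pos.mpr (Nat.cast_pos.mpr (Fact.out : p.Prime).pos)
    obtain ⟨m, hm⟩ := ((hadd x y n).eventually (Metric.closedBall_mem_nhds _ hp)).exists
    have hpow (z : R) : (⟨co (z : FR) n, hmem z n⟩ : OC) =
        ⟨co (z : FR) (n + m), hmem z (n + m)⟩ ^ p ^ m :=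
      Subtype.ext (tilt_pow_pow hco_pow (z : FR) n m).symm
    rw [map_add (PreTilt.coeff n), hE, hE, hE, hpow x, hpow y, map_pow, map_pow,
      ← add_pow_char_pow, ← map_add,
      ← map_pow]
    symm
    rw [Ideal.Quotient.eq, ← pow_one (Ideal.span _), mem_span_natCast_pow_iff_norm_le hnorm hOC]
    simpa [dist_eq_norm] using hm
  · change (((E x).untilt : OC) : C) = co (x : FR) 0
    have : (E x).untilt = Perfection.coeffMonoidHom OC p 0 (G x) := by
      have h := Perfection.coeff_zero_symm_quotientMulEquiv
        (Perfection.quotientMulEquiv p (Ideal.span {(p : OC)}) (G x))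
      rw [MulEquiv.symm_apply_apply] at h
      exact h.symm
    rw [this]
    rfl

theorem perfectRing_of_ringEquiv {A B : Type*} [CommRing A] [CommRing B] [CharP A p] [CharP B p]
    [PerfectRing B p] (e : A ≃+* B) : PerfectRing A p := by
  have h : frobenius A p = (e.symm : B →+* A).comp ((frobenius B p).comp (e : A →+* B)) := by
    ext x
    simp [frobenius_def]
  refine ⟨?_⟩
  change Function.Bijective (frobenius A p)
  rw [h]
  exact e.symm.bijective.comp ((bijective_frobenius B p).comp e.bijective)

theorem tilt_iterate_frobeniusEquiv_symm [CharP R p] [PerfectRing R p]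
    (hco_pow : ∀ x n, co x (n + 1) ^ p = co x n)
    (hone : ∀ n, co 1 n = 1) (hmul : ∀ x y n, co (x * y) n = co x n * co y n) (r : R) (i : ℕ) :
    co (((_root_.frobeniusEquiv R p).symm ^ i) r : R) 0 = co (r : FR) i := by
  set y : R := ((_root_.frobeniusEquiv R p).symm ^ i) r with hy
  have hyr : y ^ p ^ i = r := by
    have h : (_root_.frobeniusEquiv R p ^ i) y = r := by
      exact DFunLike.congr_fun
        (show _root_.frobeniusEquiv R p ^ i * (_root_.frobeniusEquiv R p)⁻¹ ^ i = 1 by simp) r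
    rw [← h]
    clear_value y
    clear h hy
    induction i with
    | zero => simp
    | succ i ih => rw [pow_succ, pow_mul, ih, pow_succ']; rfl
  have hpow (x : FR) (k : ℕ) : co (x ^ k) i = co x i ^ k := by
    induction k with
    | zero => simp [hone]
    | succ k ih => rw [pow_succ, hmul, ih, pow_succ]
  rw [← hyr, Subring.coe_pow, hpow]
  simpa using (tilt_pow_pow hco_pow (y : FR) 0 i).symm

theorem hasSum_theta [CharP R p] [PerfectRing R p] (hnorm : ‖(p : C)‖ = (p : ℝ)⁻¹)
    [CompleteSpace C] [IsUltrametricDist C]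
    (hco_pow : ∀ x n, co x (n + 1) ^ p = co x n)
    (hone : ∀ n, co 1 n = 1) (hmul : ∀ x y n, co (x * y) n = co x n * co y n)
    (hR : ∀ x : FR, x ∈ R ↔ ‖co x 0‖ ≤ 1) (hOC : ∀ c : C, c ∈ OC ↔ ‖c‖ ≤ 1)
    (θ : WittVector p R →+* OC)
    (hθ : ∀ r, (θ (WittVector.teichmuller p r) : C) = co (r : FR) 0) (a : WittVector p R) :
    HasSum (fun n : ℕ => (p : C) ^ n * co (a.coeff n : FR) n) (θ a : C) := by
  have hlt : (p : ℝ)⁻¹ < 1 :=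
    inv_lt_one_of_one_lt₀ (Nat.one_lt_cast (α := ℝ).mpr (Fact.out : p.Prime).one_lt)
  have hlim : Tendsto (fun n : ℕ => (p : ℝ)⁻¹ ^ n) atTop (𝓝 0) :=
    tendsto_pow_atTop_nhds_zero_of_lt_one (by positivity) hlt
  have hsummable : Summable (fun n : ℕ => (p : C) ^ n * co (a.coeff n : FR) n) := by
    refine Summable.of_norm_bounded (summable_geometric_of_lt_one (by positivity) hlt) fun n => ?_
    rw [norm_mul, norm_pow, hnorm]
    exact mul_le_of_le_one_right (by positivity)
      ((tilt_norm_le_one hco_pow hR _ n).mp (a.coeff n).2)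
  rw [hsummable.hasSum_iff_tendsto_nat, ← tendsto_add_atTop_iff_nat 1,
    tendsto_iff_norm_sub_tendsto_zero]
  refine squeeze_zero (fun _ => norm_nonneg _) (fun n => ?_)
    ((tendsto_add_atTop_iff_nat 1).mpr hlim)
  obtain ⟨c, hc⟩ := WittVector.dvd_sub_sum_teichmuller_iterateFrobeniusEquiv_coeff a n
  have h := congrArg (fun x => ((θ x : OC) : C)) hc
  simp only [map_sub, map_sum, map_mul, map_pow, map_natCast, AddSubgroupClass.coe_sub,
    Subring.coe_mul,
    Subring.coe_pow, Subring.coe_natCast, AddSubmonoidClass.coe_finsetSum, hθ,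
    tilt_iterate_frobeniusEquiv_symm hco_pow hone hmul] at h
  rw [norm_sub_rev, Nat.range_succ_eq_Iic]
  simp only [mul_comm ((p : C) ^ _)]
  rw [h, norm_mul, norm_pow, hnorm]
  exact mul_le_of_le_one_right (by positivity) ((hOC _).mp (θ c).2)

theorem exists_teichmuller_sub_natCast_mul_add [CharP R p] [PerfectRing R p]
    (hnorm : ‖(p : C)‖ = (p : ℝ)⁻¹)
    (hmul : ∀ x y n, co (x * y) n = co x n * co y n) (hzero : co 0 0 = 0)
    (hR : ∀ x : FR, x ∈ R ↔ ‖co x 0‖ ≤ 1) (hOC : ∀ c : C, c ∈ OC ↔ ‖c‖ ≤ 1)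
    (θ : WittVector p R →+* OC)
    (hθ : ∀ r, (θ (WittVector.teichmuller p r) : C) = co (r : FR) 0)
    (π : R) (hπ : co (π : FR) 0 = (p : C)) (a : WittVector p R) (ha : θ a = 0) :
    ∃ b c, a = (WittVector.teichmuller p π - (p : WittVector p R)) * b +
      (p : WittVector p R) * c := by
  have hp : (0 : ℝ) < (p : ℝ)⁻¹ := inv_pos.mpr (Nat.cast_pos.mpr (Fact.out : p.Prime).pos)
  have hp0 : (p : C) ≠ 0 := norm_ne_zero_iff.mp (by rw [hnorm]; exact hp.ne')
  have hπ0 : (π : FR) ≠ 0 := fun h => hp0 (by rw [← hπ, h, hzero])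
  have hmem : a - WittVector.teichmuller p (a.coeff 0) ∈ Ideal.span {(p : WittVector p R)} := by
    rw [← WittVector.ker_constantCoeff, RingHom.mem_ker, map_sub]
    simp [WittVector.constantCoeff_apply]
  obtain ⟨c, hc⟩ := Ideal.mem_span_singleton.mp hmem
  have ha0 : co (a.coeff 0 : FR) 0 = -(p * (θ c : C)) := by
    have h := congrArg (fun x => ((θ x : OC) : C)) hc
    simp only [map_sub, map_mul, map_natCast, AddSubgroupClass.coe_sub,
    Subring.coe_mul,
      Subring.coe_natCast, hθ, ha, ZeroMemClass.coe_zero] at h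
    linear_combination -h
  have hq : (a.coeff 0 : FR) / π ∈ R := by
    have h := hmul ((a.coeff 0 : FR) / π) π 0
    rw [div_mul_cancel₀ _ hπ0, ha0, hπ, ← mul_neg, mul_comm] at h
    rw [hR, ← mul_right_cancel₀ hp0 h, norm_neg]
    exact (hOC _).mp (θ c).2
  have hfac : a.coeff 0 = π * ⟨_, hq⟩ := Subtype.ext (by simp [mul_div_cancel₀ _ hπ0])
  have hT : WittVector.teichmuller p (a.coeff 0) =
      WittVector.teichmuller p π * WittVector.teichmuller p ⟨_, hq⟩ := by
    rw [← map_mul, ← hfac]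
  refine ⟨WittVector.teichmuller p ⟨_, hq⟩, c + WittVector.teichmuller p ⟨_, hq⟩, ?_⟩
  linear_combination hc + hT

end Tilt

theorem stmt10
    (p : ℕ) [Fact p.Prime]
    -- the completion `C` of an algebraic closure of `K`
    (C : Type) [NormedField C] [CompleteSpace C] [IsAlgClosed C] [IsUltrametricDist C]
    (hnorm : ‖(p : C)‖ = (p : ℝ)⁻¹)
    -- `FR` : the tilt of `C`, presented through the bijection `co` onto the set of
    -- sequences `(x^(n))` in `C` with `(x^(n+1))^p = x^(n)`, with componentwise
    -- multiplication and addition `(x+y)^(n) = lim_m (x^(n+m)+y^(n+m))^(p^m)`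
    (FR : Type) [Field FR] (co : FR → ℕ → C)
    (hco_inj : Function.Injective co)
    (hco_pow : ∀ x n, (co x (n + 1)) ^ p = co x n)
    (hco_surj : ∀ f : ℕ → C, (∀ n, (f (n + 1)) ^ p = f n) → ∃ x, co x = f)
    (hmul : ∀ x y n, co (x * y) n = co x n * co y n)
    (hone : ∀ n, co 1 n = 1)
    (hadd : ∀ x y n, Tendsto (fun m : ℕ => (co x (n + m) + co y (n + m)) ^ p ^ m)
      atTop (𝓝 (co (x + y) n)))
    -- `R` : the valuation ring of `FR`
    (R : Subring FR) (hR : ∀ x : FR, x ∈ R ↔ ‖co x 0‖ ≤ 1)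
    -- `O_C` : the valuation ring of `C`
    (OC : Subring C) (hOC : ∀ c : C, c ∈ OC ↔ ‖c‖ ≤ 1)
    -- `π ∈ R` with `π^(0) = p`
    (π : R) (hπ : co (π : FR) 0 = (p : C)) :
    -- conclusions: `W(R)` is a domain, and there is a (necessarily unique) ring
    -- homomorphism `θ : W(R) → O_C` given by `θ(a₀,a₁,…) = Σₙ pⁿ aₙ^(n)`,
    -- surjective, with kernel the principal ideal generated by `ξ = [π] - p`
    IsDomain (WittVector p R) ∧
    ∃! θ : WittVector p R →+* OC,
      (∀ a : WittVector p R,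
        ((θ a : OC) : C) = ∑' n : ℕ, (p : C) ^ n * co ((a.coeff n : R) : FR) n) ∧
      Function.Surjective θ ∧
      RingHom.ker θ =
        Ideal.span {WittVector.teichmuller p (π : R) - (p : WittVector p R)} := by
  have : Fact ¬ IsUnit (p : OC) := ⟨not_isUnit_natCast_of_norm_eq_inv hnorm hOC⟩
  have := isAdicComplete_span_natCast hnorm hOC
  obtain ⟨e, he⟩ := exists_ringEquiv_preTilt hnorm hco_inj hco_pow hco_surj hmul hadd hR hOC
  have : CharP R p :=
    charP_of_injective_ringHom (f := (e.symm : PreTilt OC p →+* R)) e.symm.injective p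
  have : PerfectRing R p := perfectRing_of_ringEquiv e
  have hp0 : (p : C) ≠ 0 := norm_ne_zero_iff.mp <| by
    rw [hnorm]
    exact inv_ne_zero (Nat.cast_ne_zero.mpr (Fact.out : p.Prime).ne_zero)
  have hzero : co 0 0 = 0 := by
    obtain ⟨x, hx⟩ := hco_surj 0 fun _ => zero_pow (Fact.out : p.Prime).ne_zero
    simpa [hx] using hmul x 0 0
  let θ : WittVector p R →+* OC :=
    (WittVector.fontaineTheta OC p).comp (WittVector.map (e : R →+* PreTilt OC p))
  have hθ (r : R) : (θ (WittVector.teichmuller p r) : C) = co (r : FR) 0 := by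
    simp [θ, he]
  have hsum (a : WittVector p R) :
      (θ a : C) = ∑' n : ℕ, (p : C) ^ n * co ((a.coeff n : R) : FR) n :=
    (hasSum_theta hnorm hco_pow hone hmul hR hOC θ hθ a).tsum_eq.symm
  refine ⟨inferInstance, θ, ⟨hsum, ?_, ?_⟩, ?_⟩
  · exact (surjective_fontaineTheta (frobenius_modP_surjective hOC)).comp
      (WittVector.map_surjective _ e.surjective)
  · refine ker_eq_span_singleton_of_isAdicComplete θ p _ ?_ ?_ ?_
    · refine Subtype.ext ?_
      simp [hθ, hπ]
    · intro b hb
      rw [map_natCast] at hb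
      have h : (p : C) * (b : C) = 0 := by simpa using congrArg Subtype.val hb
      exact Subtype.ext ((mul_eq_zero.mp h).resolve_left hp0)
    · exact exists_teichmuller_sub_natCast_mul_add hnorm hmul hzero hR hOC θ hθ π hπ
  · rintro θ' ⟨h, -, -⟩
    exact RingHom.ext fun a => Subtype.ext ((h a).trans (hsum a).symm)
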